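/- Let G be an almost Moore digraph of degree d > 1 and diameter k > 1 with self-repeats whose permutation cycle structure is (k, …, m_{d−1}, 0, …, 0), i.e. r has exactly k fixed points and every cycle of r has length at most d − 1. If ℓ and j are positive integers with ℓ(d−1) < k + 1, then the set R_{ℓ,j}(G) = {v ∈ V(G) : there is a directed walk of length ℓ from r^j(v) to v} is empty. -/

import Mathlib

/-- `IsWalkFrom A u v l` : the list `u :: l` is a directed walk from `u` to `v`
along the adjacency relation `A`; the length of the walk is `l.length`. -/
def IsWalkFrom {V : Type} (A : V → V → Prop) (u v : V) (l : List V) : Prop :=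
  List.Chain A u l ∧ (u :: l).getLast (List.cons_ne_nil u l) = v

/-- An almost Moore digraph (a `(d,k)`-digraph): a diregular digraph of degree `d > 1`,
diameter `k > 1` and order `d + d² + ⋯ + d^k`, together with its repeat permutation `rep`:
for every vertex `v`, every vertex `w ≠ rep v` is reached from `v` by exactly one walk of
length at most `k`, while `rep v` is reached by exactly two such walks, at least one of
which has length `k`.  The map `rep` is an automorphism of the digraph. -/
structure AlmostMooreDigraph (d k : ℕ) where
  hd : 1 < d
  hk : 1 < k
  V : Type
  [fintypeV : Fintype V]
  [decEqV : DecidableEq V]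
  Adj : V → V → Prop
  [adjDec : DecidableRel Adj]
  loopless : ∀ v, ¬ Adj v v
  out_deg : ∀ v, {w | Adj v w}.ncard = d
  in_deg : ∀ v, {w | Adj w v}.ncard = d
  reach : ∀ u v, ∃ l, IsWalkFrom Adj u v l ∧ l.length ≤ k
  diam : ∃ u v, ∀ l, IsWalkFrom Adj u v l → k ≤ l.length
  card_eq : Fintype.card V = ∑ i ∈ Finset.range k, d ^ (i + 1)
  rep : V → V
  rep_spec : ∀ v w, w ≠ rep v → ∃! l, IsWalkFrom Adj v w l ∧ l.length ≤ k
  rep_two : ∀ v, ∃ l₁ l₂, l₁ ≠ l₂ ∧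
      IsWalkFrom Adj v (rep v) l₁ ∧ l₁.length ≤ k ∧
      IsWalkFrom Adj v (rep v) l₂ ∧ l₂.length ≤ k ∧
      (l₁.length = k ∨ l₂.length = k) ∧
      (∀ l, IsWalkFrom Adj v (rep v) l → l.length ≤ k → l = l₁ ∨ l = l₂)
  rep_bijective : Function.Bijective rep
  rep_adj : ∀ u v, Adj u v ↔ Adj (rep u) (rep v)

attribute [instance] AlmostMooreDigraph.fintypeV AlmostMooreDigraph.decEqV
  AlmostMooreDigraph.adjDec

/-- `ordRep M v` : the smallest `t ≥ 1` with `rep^t v = v`. -/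
noncomputable def ordRep {d k : ℕ} (M : AlmostMooreDigraph d k) (v : M.V) : ℕ :=
  sInf {t | 0 < t ∧ M.rep^[t] v = v}

/-- The vertex set of the subdigraph `H_α`: vertices whose order under the repeat
permutation divides `2^t * α` for some `t ≥ 0`. -/
def Hset {d k : ℕ} (M : AlmostMooreDigraph d k) (α : ℕ) : Set M.V :=
  {v | ∃ t : ℕ, ordRep M v ∣ 2 ^ t * α}

theorem IsWalkFrom.append {V : Type} {A : V → V → Prop} {u v w : V} {l₁ l₂ : List V}
    (h₁ : IsWalkFrom A u v l₁) (h₂ : IsWalkFrom A v w l₂) : IsWalkFrom A u w (l₁ ++ l₂) := by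
  induction l₁ generalizing u with
  | nil =>
    obtain rfl : u = v := h₁.2
    exact h₂
  | cons a l ih =>
    have hc := List.isChain_cons_cons.1 h₁.1
    have ha : IsWalkFrom A a v l := ⟨hc.2, by simpa using h₁.2⟩
    exact ⟨List.isChain_cons_cons.2 ⟨hc.1, (ih ha).1⟩, by simpa using (ih ha).2⟩

theorem IsWalkFrom.map {V : Type} {A : V → V → Prop} {f : V → V}
    (hf : ∀ x y, A x y → A (f x) (f y)) {u v : V} {l : List V} (h : IsWalkFrom A u v l) :
    IsWalkFrom A (f u) (f v) (l.map f) := by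
  induction l generalizing u with
  | nil =>
    obtain rfl : u = v := h.2
    exact ⟨List.isChain_singleton _, rfl⟩
  | cons a l ih =>
    have hc := List.isChain_cons_cons.1 h.1
    have ha := ih ⟨hc.2, by simpa using h.2⟩
    exact ⟨List.isChain_cons_cons.2 ⟨hf _ _ hc.1, ha.1⟩, by simpa using ha.2⟩

/-- Concatenating the images of a walk from `f v` to `v` under the iterates of an
endomorphism `f` gives a walk from `f^t v` to `v`. -/
theorem IsWalkFrom.exists_iterate {V : Type} {A : V → V → Prop} {f : V → V}
    (hf : ∀ x y, A x y → A (f x) (f y)) {v : V} {l : List V} (h : IsWalkFrom A (f v) v l)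
    (t : ℕ) : ∃ l', IsWalkFrom A (f^[t] v) v l' ∧ l'.length = t * l.length := by
  induction t with
  | zero => exact ⟨[], ⟨List.isChain_singleton _, rfl⟩, by simp⟩
  | succ t ih =>
    obtain ⟨l', hl', hlen⟩ := ih
    refine ⟨l'.map f ++ l, ?_, by simp [hlen, Nat.succ_mul]⟩
    rw [Function.iterate_succ_apply']
    exact (hl'.map hf).append h

namespace AlmostMooreDigraph

variable {d k : ℕ} (M : AlmostMooreDigraph d k)

theorem ordRep_spec (v : M.V) : 0 < ordRep M v ∧ M.rep^[ordRep M v] v = v := by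
  have hmem : v ∈ Function.periodicPts M.rep := M.rep_bijective.injective.mem_periodicPts v
  obtain ⟨n, hn, hp⟩ := hmem
  exact Nat.sInf_mem (s := {t | 0 < t ∧ M.rep^[t] v = v}) ⟨n, hn, hp⟩

theorem adj_iterate_rep (j : ℕ) (x y : M.V) (h : M.Adj x y) :
    M.Adj (M.rep^[j] x) (M.rep^[j] y) := by
  induction j with
  | zero => exact h
  | succ j ih =>
    rw [Function.iterate_succ_apply', Function.iterate_succ_apply']
    exact (M.rep_adj _ _).1 ih

/-- A nontrivial closed walk of length at most `k` has length exactly `k`, and its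
base point is a self-repeat. -/
theorem closed_walk {v : M.V} {l : List M.V} (h : IsWalkFrom M.Adj v v l)
    (hpos : 0 < l.length) (hle : l.length ≤ k) : M.rep v = v ∧ l.length = k := by
  have hnil : IsWalkFrom M.Adj v v [] := ⟨List.isChain_singleton _, rfl⟩
  have hfix : M.rep v = v := by
    by_contra hne
    have := (M.rep_spec v v (Ne.symm hne)).unique ⟨h, hle⟩ ⟨hnil, Nat.zero_le k⟩
    simp [this] at hpos
  refine ⟨hfix, ?_⟩
  obtain ⟨l₁, l₂, -, -, -, -, -, hk, huniq⟩ := M.rep_two v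
  rw [hfix] at huniq
  have hk1 := M.hk
  rcases huniq l h hle with rfl | rfl <;> rcases huniq [] hnil (Nat.zero_le k) with rfl | rfl <;>
    simp at hk hpos <;> omega

theorem lt_card : k < Fintype.card M.V := by
  have hd := M.hd
  have hk := M.hk
  have h : ∑ _i ∈ Finset.range k, 2 ≤ ∑ i ∈ Finset.range k, d ^ (i + 1) :=
    Finset.sum_le_sum fun i _ => hd.trans_le (Nat.le_self_pow (Nat.succ_ne_zero i) d)
  rw [M.card_eq]
  simp at h
  omega

end AlmostMooreDigraph

/-- Let `G` be an almost Moore digraph with self-repeats whose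
permutation cycle structure is `(k, …, m_{d−1}, 0, …, 0)`, i.e. `r` has exactly `k`
fixed points and every vertex has order at most `d − 1` under `r`.  If `ℓ, j ≥ 1` and
`ℓ(d−1) < k + 1`, then the set `R_{ℓ,j}(G)` of vertices `v` admitting a directed walk of
length `ℓ` from `r^j(v)` to `v` is empty. -/
theorem stmt12 {d k : ℕ} (M : AlmostMooreDigraph d k) (hsr : ∃ v, M.rep v = v)
    (hm1 : {v | M.rep v = v}.ncard = k)
    (hord : ∀ v : M.V, ordRep M v ≤ d - 1)
    (ℓ j : ℕ) (hℓ : 0 < ℓ) (hj : 0 < j) (hbound : ℓ * (d - 1) < k + 1) :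
    {v : M.V | ∃ l : List M.V, IsWalkFrom M.Adj (M.rep^[j] v) v l ∧ l.length = ℓ} = ∅ := by
  refine Set.eq_empty_iff_forall_notMem.2 ?_
  rintro v ⟨l, hl, rfl⟩
  have hk := M.hk
  obtain ⟨hpos, hper⟩ := M.ordRep_spec v
  obtain ⟨c, hc, hlen⟩ := hl.exists_iterate (M.adj_iterate_rep j) (ordRep M v)
  have hper' : (M.rep^[j])^[ordRep M v] v = v := by
    rw [← Function.iterate_mul, mul_comm, Function.iterate_mul]
    exact Function.iterate_fixed hper j
  rw [hper'] at hc
  have hle : ordRep M v * l.length ≤ l.length * (d - 1) := by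
    rw [mul_comm]
    exact Nat.mul_le_mul_left _ (hord v)
  have hfix := (M.closed_walk hc (hlen ▸ Nat.mul_pos hpos hℓ) (by omega)).1
  rw [Function.iterate_fixed hfix j] at hl
  have hℓd : l.length ≤ l.length * (d - 1) :=
    Nat.le_mul_of_pos_right _ (Nat.sub_pos_of_lt M.hd)
  have hℓk := (M.closed_walk hl hℓ (by omega)).2
  rw [hℓk] at hbound
  have hd : d - 1 ≤ 1 := by
    by_contra! h
    have := Nat.mul_le_mul_left k h
    omega
  have huniv : {v | M.rep v = v} = Set.univ := by
    refine Set.eq_univ_of_forall fun w => ?_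
    obtain ⟨hw, hwper⟩ := M.ordRep_spec w
    have h1 : ordRep M w = 1 := le_antisymm ((hord w).trans hd) hw
    rwa [h1] at hwper
  rw [huniv, Set.ncard_univ, Nat.card_eq_fintype_card] at hm1
  exact M.lt_card.ne' hm1
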